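/- Fix constants 0 < c1 ≤ c2 and ε > 0. For every B ≥ 0 there exists C = C(c1, c2, ε, B) such that the following holds: for every T > 1, every integer d ≥ 2 with c1·T ≤ d ≤ c2·T, every r_f = i·ρ_f with ρ_f ∈ ℝ and c1·T ≤ |ρ_f| ≤ c2·T, and every real y with 0 < |y| ≤ d/30, one has |Φ_{w4}(y; d)| ≤ C·T^{−B}. -/

import Mathlib

open MeasureTheory Finset Set
open scoped Real

noncomputable section

/-- `e(x) = exp(2πi x)`. -/
def eFn (x : ℝ) : ℂ := Complex.exp (2 * (Real.pi : ℂ) * Complex.I * (x : ℂ))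

/-- `Q(d,s) = Γ((d−1)/2 + s)/Γ((d+1)/2 − s)`. -/
def Qfun (d : ℕ) (s : ℂ) : ℂ :=
  Complex.Gamma (((d : ℂ) - 1) / 2 + s) / Complex.Gamma (((d : ℂ) + 1) / 2 - s)

/-- The `w₄` Bessel kernel `K_{w₄}(y; d, r)`, written as an integral over the vertical
line `Re s = 1/12` (a fixed choice of `σ ∈ (0, 1/6)`; the value is independent of this
choice): `K_{w₄}(y;d,r) = ((εi)^d/4π²) ∫ |8π³y|^{1−r−s} Q(d,s) Γ(s+3r) e^{εiπ(s+3r)/2}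
ds/(2πi)` with `ε = sgn y`. -/
def Kw4 (y : ℝ) (d : ℕ) (r : ℂ) : ℂ :=
  (((Real.sign y : ℂ) * Complex.I) ^ d / (4 * (Real.pi : ℂ) ^ 2)) *
    (1 / (2 * (Real.pi : ℂ))) *
    ∫ t : ℝ,
      ((|8 * Real.pi ^ 3 * y| : ℝ) : ℂ) ^
          ((1 : ℂ) - r - ((1 / 12 : ℂ) + (t : ℂ) * Complex.I)) *
        Qfun d ((1 / 12 : ℂ) + (t : ℂ) * Complex.I) *
        Complex.Gamma ((1 / 12 : ℂ) + (t : ℂ) * Complex.I + 3 * r) *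
        Complex.exp ((Real.sign y : ℂ) * Complex.I * (Real.pi : ℂ) *
          ((1 / 12 : ℂ) + (t : ℂ) * Complex.I + 3 * r) / 2)

/-- The spectral density `spec^d(r) = (1/8π³)(d−1)((d−1)²/4 − 9r²)`. -/
def specd (d : ℕ) (r : ℂ) : ℂ :=
  (1 / (8 * (Real.pi : ℂ) ^ 3)) * ((d : ℂ) - 1) * (((d : ℂ) - 1) ^ 2 / 4 - 9 * r ^ 2)

/-- The spectral test function `F(r) = exp((r − r_f)²/T^ε)` with `r_f = iρ_f`. -/
def Ffun (T ε0 ρf : ℝ) (r : ℂ) : ℂ :=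
  Complex.exp ((r - Complex.I * (ρf : ℂ)) ^ 2 / ((T ^ ε0 : ℝ) : ℂ))

/-- `Φ_{w₄}(y; d) = (1/|y|) ∫_{(0)} F(r) K_{w₄}(y; d, r) spec^d(r) dr/(2πi)`,
written as `(1/|y|)(1/2π) ∫_ℝ F(it) K_{w₄}(y; d, it) spec^d(it) dt`. -/
def Phiw4 (T ε0 ρf : ℝ) (d : ℕ) (y : ℝ) : ℂ :=
  (1 / ((|y| : ℝ) : ℂ)) * (1 / (2 * (Real.pi : ℂ))) *
    ∫ t : ℝ, Ffun T ε0 ρf ((t : ℂ) * Complex.I) * Kw4 y d ((t : ℂ) * Complex.I) *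
      specd d ((t : ℂ) * Complex.I)

/-- The Beta-integral bound for ratios of Gamma values. -/
lemma gamma_ratio_le (z : ℂ) (hz : 0 < z.re) (c : ℝ) (hc : 0 ≤ c) :
    ‖Complex.Gamma z‖ * Real.Gamma (z.re + c) ≤
      Real.Gamma z.re * ‖Complex.Gamma (z + c)‖ := by
  rcases hc.eq_or_lt with rfl | hc
  · simp [mul_comm]
  have h1 := Complex.Gamma_mul_Gamma_eq_betaIntegral (s := z) (t := (c : ℂ)) hz (by simpa using hc)
  have h2 := Complex.Gamma_mul_Gamma_eq_betaIntegral (s := (z.re : ℂ)) (t := (c : ℂ))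
    (by simpa using hz) (by simpa using hc)
  have hreal : Complex.betaIntegral (z.re : ℂ) (c : ℂ) =
      ((∫ x in (0:ℝ)..1, x ^ (z.re - 1) * (1 - x) ^ (c - 1) : ℝ) : ℂ) := by
    rw [Complex.betaIntegral, ← intervalIntegral.integral_ofReal]
    apply intervalIntegral.integral_congr
    intro x hx
    rw [Set.uIcc_of_le zero_le_one] at hx
    simp only
    rw [Complex.ofReal_mul, Complex.ofReal_cpow hx.1, Complex.ofReal_cpow (by linarith [hx.2])]
    push_cast
    rfl
  have hle : ‖Complex.betaIntegral z (c : ℂ)‖ ≤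
      ∫ x in (0:ℝ)..1, x ^ (z.re - 1) * (1 - x) ^ (c - 1) := by
    rw [Complex.betaIntegral]
    refine (intervalIntegral.norm_integral_le_integral_norm zero_le_one).trans (le_of_eq ?_)
    rw [intervalIntegral.integral_of_le zero_le_one, intervalIntegral.integral_of_le zero_le_one,
      MeasureTheory.integral_Ioc_eq_integral_Ioo, MeasureTheory.integral_Ioc_eq_integral_Ioo]
    apply MeasureTheory.setIntegral_congr_fun measurableSet_Ioo
    intro x hx
    simp only
    rw [norm_mul, Complex.norm_cpow_eq_rpow_re_of_pos hx.1,
      show (1 - (x : ℂ)) = ((1 - x : ℝ) : ℂ) by push_cast; rfl,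
      Complex.norm_cpow_eq_rpow_re_of_pos (by linarith [hx.2])]
    simp
  rw [hreal] at h2
  set b := ∫ x in (0:ℝ)..1, x ^ (z.re - 1) * (1 - x) ^ (c - 1) with hb
  have htwo : Real.Gamma z.re * Real.Gamma c = Real.Gamma (z.re + c) * b := by
    rw [← Complex.ofReal_add, Complex.Gamma_ofReal, Complex.Gamma_ofReal,
      Complex.Gamma_ofReal] at h2
    exact_mod_cast h2
  have hG : 0 < Real.Gamma c := Real.Gamma_pos_of_pos hc
  have h1' : ‖Complex.Gamma z‖ * Real.Gamma c =
      ‖Complex.Gamma (z + c)‖ * ‖Complex.betaIntegral z c‖ := by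
    rw [← norm_mul, ← h1, norm_mul, Complex.Gamma_ofReal, Complex.norm_real,
      Real.norm_of_nonneg hG.le]
  have hG2 : 0 < Real.Gamma (z.re + c) := Real.Gamma_pos_of_pos (by linarith)
  refine le_of_mul_le_mul_right ?_ hG
  calc ‖Complex.Gamma z‖ * Real.Gamma (z.re + c) * Real.Gamma c
      = ‖Complex.Gamma (z + c)‖ * ‖Complex.betaIntegral z c‖ * Real.Gamma (z.re + c) := by
        rw [← h1']; ring
    _ ≤ ‖Complex.Gamma (z + c)‖ * b * Real.Gamma (z.re + c) := by gcongr
    _ = Real.Gamma z.re * ‖Complex.Gamma (z + c)‖ * Real.Gamma c := by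
        linear_combination -‖Complex.Gamma (z + c)‖ * htwo

/-- A local three-lines estimate with an exponential weight. -/
lemma three_lines_local (f : ℂ → ℂ) (hf : ∀ z : ℂ, 0 ≤ z.re → z.re ≤ 1 → DifferentiableAt ℂ f z)
    (M : ℝ) (hM : ∀ z : ℂ, 0 ≤ z.re → z.re ≤ 1 → ‖f z‖ ≤ M) (τ E0 E1 θ : ℝ)
    (hE0 : 0 ≤ E0) (hE1 : 0 ≤ E1) (hθ0 : 0 ≤ θ) (hθ1 : θ ≤ 1)
    (h0 : ∀ v : ℝ, ‖f ((v : ℂ) * Complex.I)‖ ≤ E0 * Real.exp (3 * |v - τ|))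
    (h1 : ∀ v : ℝ, ‖f (1 + (v : ℂ) * Complex.I)‖ ≤ E1 * Real.exp (3 * |v - τ|)) :
    ‖f (θ + (τ : ℂ) * Complex.I)‖ ≤ Real.exp 4 * (E0 ^ (1 - θ) * E1 ^ θ) := by
  set G : ℂ → ℂ := fun s => f (s + (τ : ℂ) * Complex.I) * Complex.exp (s ^ 2) with hG
  have hnorm : ∀ s : ℂ, ‖Complex.exp (s ^ 2)‖ = Real.exp (s.re ^ 2 - s.im ^ 2) := by
    intro s
    rw [Complex.norm_exp]
    congr 1
    simp [pow_two]
  have hq : ∀ v : ℝ, 3 * |v| + (1 - v ^ 2) ≤ 4 := by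
    intro v
    nlinarith [sq_abs v, sq_nonneg (|v| - 3 / 2)]
  have hdiff : ∀ z : ℂ, 0 ≤ z.re → z.re ≤ 1 → DifferentiableAt ℂ G z := by
    intro z hz0 hz1
    have : DifferentiableAt ℂ (fun s : ℂ => f (s + (τ : ℂ) * Complex.I)) z := by
      have := hf (z + (τ : ℂ) * Complex.I) (by simpa using hz0) (by simpa using hz1)
      exact this.comp z (by fun_prop : DifferentiableAt ℂ (fun s : ℂ => s + (τ : ℂ) * Complex.I) z)
    exact this.mul (by fun_prop)
  have hclos : closure (Complex.HadamardThreeLines.verticalStrip 0 1) ⊆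
      {z : ℂ | 0 ≤ z.re ∧ z.re ≤ 1} := by
    apply closure_minimal
    · intro z hz
      exact ⟨hz.1.le, hz.2.le⟩
    · exact (isClosed_le continuous_const Complex.continuous_re).inter
        (isClosed_le Complex.continuous_re continuous_const)
  have hd : DiffContOnCl ℂ G (Complex.HadamardThreeLines.verticalStrip 0 1) := by
    constructor
    · intro z hz
      exact (hdiff z hz.1.le hz.2.le).differentiableWithinAt
    · intro z hz
      exact (hdiff z (hclos hz).1 (hclos hz).2).continuousAt.continuousWithinAt
  have hB : BddAbove ((norm ∘ G) '' Complex.HadamardThreeLines.verticalClosedStrip 0 1) := by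
    refine ⟨M * Real.exp 1, ?_⟩
    rintro _ ⟨z, hz, rfl⟩
    have hz0 : 0 ≤ z.re := hz.1
    have hz1 : z.re ≤ 1 := hz.2
    simp only [Function.comp, hG, norm_mul, hnorm]
    have := hM (z + (τ : ℂ) * Complex.I) (by simpa using hz0) (by simpa using hz1)
    have hM0 : 0 ≤ M := (norm_nonneg _).trans this
    gcongr
    nlinarith [sq_nonneg z.im]
  have ha : ∀ z ∈ Complex.re ⁻¹' {(0 : ℝ)}, ‖G z‖ ≤ E0 * Real.exp 4 := by
    intro z hz
    have hz' : z.re = 0 := hz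
    simp only [hG, norm_mul, hnorm]
    have h := h0 (z.im + τ)
    have e : ((z.im + τ : ℝ) : ℂ) * Complex.I = z + (τ : ℂ) * Complex.I := by
      apply Complex.ext <;> simp [hz']
    rw [e] at h
    calc _ ≤ E0 * Real.exp (3 * |z.im + τ - τ|) * Real.exp (z.re ^ 2 - z.im ^ 2) := by gcongr
      _ = E0 * Real.exp (3 * |z.im| + (z.re ^ 2 - z.im ^ 2)) := by
        rw [Real.exp_add, add_sub_cancel_right]; ring
      _ ≤ _ := by
        gcongr
        have := hq z.im
        rw [hz']
        linarith
  have hb : ∀ z ∈ Complex.re ⁻¹' {(1 : ℝ)}, ‖G z‖ ≤ E1 * Real.exp 4 := by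
    intro z hz
    have hz' : z.re = 1 := hz
    simp only [hG, norm_mul, hnorm]
    have h := h1 (z.im + τ)
    have e : 1 + ((z.im + τ : ℝ) : ℂ) * Complex.I = z + (τ : ℂ) * Complex.I := by
      apply Complex.ext <;> simp [hz']
    rw [e] at h
    calc _ ≤ E1 * Real.exp (3 * |z.im + τ - τ|) * Real.exp (z.re ^ 2 - z.im ^ 2) := by gcongr
      _ = E1 * Real.exp (3 * |z.im| + (z.re ^ 2 - z.im ^ 2)) := by
        rw [Real.exp_add, add_sub_cancel_right]; ring
      _ ≤ _ := by
        gcongr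
        have := hq z.im
        rw [hz']
        linarith
  have key := Complex.HadamardThreeLines.norm_le_interp_of_mem_verticalClosedStrip₀₁' G
    (z := (θ : ℂ)) (a := E0 * Real.exp 4) (b := E1 * Real.exp 4)
    ⟨by simpa using hθ0, by simpa using hθ1⟩ hd hB ha hb
  simp only [hG, norm_mul, hnorm, Complex.ofReal_re, Complex.ofReal_im] at key
  have hge : 1 ≤ Real.exp (θ ^ 2 - 0 ^ 2) := Real.one_le_exp (by nlinarith [sq_nonneg θ])
  calc ‖f (θ + (τ : ℂ) * Complex.I)‖
      ≤ ‖f (θ + (τ : ℂ) * Complex.I)‖ * Real.exp (θ ^ 2 - 0 ^ 2) :=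
        le_mul_of_one_le_right (norm_nonneg _) hge
    _ ≤ _ := key
    _ = _ := by
      rw [Real.mul_rpow hE0 (Real.exp_pos _).le, Real.mul_rpow hE1 (Real.exp_pos _).le]
      have : Real.exp 4 ^ (1 - θ) * Real.exp 4 ^ θ = Real.exp 4 := by
        rw [← Real.rpow_add (Real.exp_pos _)]; simp
      calc _ = (Real.exp 4 ^ (1 - θ) * Real.exp 4 ^ θ) * (E0 ^ (1 - θ) * E1 ^ θ) := by ring
        _ = _ := by rw [this]

/-- Shifting a vertical contour. -/
lemma contour_shift (f : ℂ → ℂ) (A : ℝ) (hA : 0 ≤ A)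
    (hf : ∀ z : ℂ, 0 ≤ z.re → z.re ≤ A → DifferentiableAt ℂ f z)
    (g : ℝ → ℝ) (hg : Integrable g)
    (hg1 : Filter.Tendsto g Filter.atTop (nhds 0)) (hg2 : Filter.Tendsto g Filter.atBot (nhds 0))
    (hb : ∀ x t : ℝ, 0 ≤ x → x ≤ A → ‖f (x + (t : ℂ) * Complex.I)‖ ≤ g t) :
    ∫ t : ℝ, f ((t : ℂ) * Complex.I) = ∫ t : ℝ, f (A + (t : ℂ) * Complex.I) := by
  have hcont : ∀ x : ℝ, 0 ≤ x → x ≤ A →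
      Continuous (fun t : ℝ => f (x + (t : ℂ) * Complex.I)) := by
    intro x hx0 hx1
    rw [continuous_iff_continuousAt]
    intro t
    have := (hf (x + (t : ℂ) * Complex.I) (by simpa using hx0) (by simpa using hx1)).continuousAt
    exact ContinuousAt.comp (f := fun t : ℝ => (x + (t : ℂ) * Complex.I)) this (by fun_prop)
  have hfi : ∀ x : ℝ, 0 ≤ x → x ≤ A →
      Integrable (fun t : ℝ => f (x + (t : ℂ) * Complex.I)) := by
    intro x hx0 hx1
    exact hg.mono' (hcont x hx0 hx1).aestronglyMeasurable
      (Filter.Eventually.of_forall fun t => hb x t hx0 hx1)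
  have hrect : ∀ R : ℝ, (∫ t in (-R)..R, f (A + (t : ℂ) * Complex.I)) -
      (∫ t in (-R)..R, f ((t : ℂ) * Complex.I)) =
      Complex.I * ((∫ x in (0:ℝ)..A, f (x + ((-R : ℝ) : ℂ) * Complex.I)) -
        (∫ x in (0:ℝ)..A, f (x + (R : ℂ) * Complex.I))) := by
    intro R
    have := Complex.integral_boundary_rect_eq_zero_of_differentiableOn f
      ((0 : ℝ) + ((-R : ℝ) : ℂ) * Complex.I) ((A : ℂ) + (R : ℂ) * Complex.I) (by
        intro z hz
        have hz1 := hz.1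
        simp [Set.uIcc_of_le hA] at hz1
        exact (hf z hz1.1 hz1.2).differentiableWithinAt)
    simp only [Complex.add_re, Complex.ofReal_re, Complex.mul_re, Complex.I_re, mul_zero,
      Complex.ofReal_im, Complex.I_im, mul_one, sub_self, add_zero, Complex.add_im,
      Complex.mul_im, zero_add, smul_eq_mul, Complex.ofReal_zero] at this
    have hI : Complex.I * Complex.I = -1 := Complex.I_mul_I
    linear_combination (-Complex.I) * this + ((∫ t in (-R)..R, f (A + (t : ℂ) * Complex.I)) -
      (∫ t in (-R)..R, f ((t : ℂ) * Complex.I))) * hI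
  have hlim1 := intervalIntegral_tendsto_integral (hfi A hA le_rfl)
    Filter.tendsto_neg_atTop_atBot Filter.tendsto_id
  have hfi0 : Integrable (fun t : ℝ => f ((t : ℂ) * Complex.I)) := by
    simpa using hfi 0 le_rfl hA
  have hlim0 := intervalIntegral_tendsto_integral hfi0
    Filter.tendsto_neg_atTop_atBot Filter.tendsto_id
  have hz : ∀ φ : ℝ → ℝ, Filter.Tendsto (fun R => g (φ R)) Filter.atTop (nhds 0) →
      Filter.Tendsto (fun R : ℝ => ∫ x in (0:ℝ)..A, f (x + ((φ R : ℝ) : ℂ) * Complex.I))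
        Filter.atTop (nhds 0) := by
    intro φ hφ
    have h2 : Filter.Tendsto (fun R => g (φ R) * |A - 0|) Filter.atTop (nhds 0) := by
      simpa using hφ.mul_const |A - 0|
    refine squeeze_zero_norm (fun R => ?_) h2
    apply intervalIntegral.norm_integral_le_of_norm_le_const
    intro x hx
    rw [Set.uIoc_of_le hA] at hx
    exact hb x (φ R) hx.1.le hx.2
  have hzR := hz (fun R => R) hg1
  have hzN := hz (fun R => -R) (hg2.comp Filter.tendsto_neg_atTop_atBot)
  have hlim := hlim1.sub hlim0
  have hlim' := (hzN.sub hzR).const_mul Complex.I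
  simp only [id] at hlim
  simp_rw [hrect] at hlim
  have := tendsto_nhds_unique hlim hlim'
  simp only [sub_zero, mul_zero] at this
  exact (sub_eq_zero.mp this).symm

lemma norm_gamma_le (z : ℂ) (hz : 0 < z.re) : ‖Complex.Gamma z‖ ≤ Real.Gamma z.re := by
  rw [Complex.Gamma_eq_integral hz, Real.Gamma_eq_integral hz, Complex.GammaIntegral]
  refine (norm_integral_le_integral_norm _).trans (le_of_eq ?_)
  apply setIntegral_congr_fun measurableSet_Ioi
  intro x hx
  have hx' : (0:ℝ) < x := hx
  simp only
  rw [norm_mul, Complex.norm_cpow_eq_rpow_re_of_pos hx', Complex.norm_real,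
    Real.norm_of_nonneg (Real.exp_pos _).le]
  simp

lemma norm_gamma_half (v : ℝ) :
    ‖Complex.Gamma (1 / 2 + (v : ℂ) * Complex.I)‖ ≤ 3 * Real.exp (-(π / 2) * |v|) := by
  have h := Complex.Gamma_mul_Gamma_one_sub (1 / 2 + (v : ℂ) * Complex.I)
  have hc : (1 : ℂ) - (1 / 2 + (v : ℂ) * Complex.I) =
      (starRingEnd ℂ) (1 / 2 + (v : ℂ) * Complex.I) := by
    simp only [map_add, map_mul, Complex.conj_I, Complex.conj_ofReal, map_div₀, map_one,
      Complex.conj_ofNat]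
    ring
  rw [hc, Complex.Gamma_conj] at h
  have hs : Complex.sin ((π : ℂ) * (1 / 2 + (v : ℂ) * Complex.I)) = (Real.cosh (π * v) : ℝ) := by
    rw [show (π : ℂ) * (1 / 2 + (v : ℂ) * Complex.I) =
      ((π * v : ℝ) : ℂ) * Complex.I + (π : ℂ) / 2 by push_cast; ring,
      Complex.sin_add_pi_div_two, Complex.cos_mul_I, Complex.ofReal_cosh]
  rw [hs] at h
  have h2 := congrArg norm h
  rw [norm_mul, Complex.norm_conj, norm_div, Complex.norm_real, Complex.norm_real,
    Real.norm_of_nonneg Real.pi_pos.le, Real.norm_of_nonneg (Real.cosh_pos _).le] at h2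
  have hcosh : Real.exp (π * |v|) / 2 ≤ Real.cosh (π * v) := by
    rw [← Real.cosh_abs, abs_mul, abs_of_pos Real.pi_pos, Real.cosh_eq]
    have := Real.exp_pos (-(π * |v|))
    linarith
  refine abs_le_of_sq_le_sq' ?_ (by positivity) |>.2
  rw [pow_two, h2, div_le_iff₀ (Real.cosh_pos _), mul_pow, ← Real.exp_nat_mul]
  have e : Real.exp ((2 : ℕ) * (-(π / 2) * |v|)) * Real.exp (π * |v|) = 1 := by
    rw [← Real.exp_add]
    simp
    ring
  have hp := Real.exp_pos ((2 : ℕ) * (-(π / 2) * |v|))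
  have hpi := Real.pi_lt_d2
  nlinarith [mul_le_mul_of_nonneg_left hcosh hp.le]

lemma one_add_abs_le (v τ : ℝ) : 1 + |v| ≤ (1 + |τ|) * Real.exp |v - τ| := by
  have h1 : |v| ≤ |τ| + |v - τ| := by
    have := abs_add_le τ (v - τ)
    simpa using this
  have h2 := Real.add_one_le_exp |v - τ|
  nlinarith [abs_nonneg τ, abs_nonneg (v - τ)]

lemma gamma_decay (τ : ℝ) :
    ‖Complex.Gamma (1 / 12 + (τ : ℂ) * Complex.I)‖ * Real.exp (π / 2 * |τ|) ≤
      39 * Real.exp 4 * (1 + |τ|) ^ (-(5 / 12) : ℝ) := by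
  have hpi := Real.pi_lt_d2
  have hpi0 := Real.pi_pos
  set ex := Real.exp (-(π / 2) * |τ|) with hex
  have hexp : ∀ v : ℝ, Real.exp (-(π / 2) * |v|) ≤ ex * Real.exp (2 * |v - τ|) := by
    intro v
    rw [hex, ← Real.exp_add]
    apply Real.exp_le_exp.mpr
    have h1 : |τ| ≤ |v| + |v - τ| := by
      have := abs_sub_abs_le_abs_sub τ v
      rw [abs_sub_comm τ v] at this
      linarith
    nlinarith [abs_nonneg (v - τ)]
  obtain ⟨M, hM⟩ : ∃ M, ∀ x ∈ Set.Icc (1/2 : ℝ) (3/2), ‖Real.Gamma x‖ ≤ M := by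
    apply isCompact_Icc.exists_bound_of_continuousOn
    intro x hx
    apply (Real.differentiableAt_Gamma _).continuousAt.continuousWithinAt
    intro m
    have := hx.1
    have hm : (0:ℝ) ≤ m := Nat.cast_nonneg m
    linarith
  have key := three_lines_local (fun s => Complex.Gamma (s + 1 / 2)) ?_ M ?_ τ (3 * ex)
    (3 * ex * (1 + |τ|)) (7 / 12) (by positivity) (by positivity) (by norm_num) (by norm_num) ?_ ?_
  · beta_reduce at key
    have e1 : (((7 / 12 : ℝ) : ℂ) + (τ : ℂ) * Complex.I + 1 / 2) =
        (1 / 12 + (τ : ℂ) * Complex.I) + 1 := by push_cast; ring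
    have hne : (1 / 12 + (τ : ℂ) * Complex.I) ≠ 0 := by
      intro h
      have := congrArg Complex.re h
      norm_num at this
    rw [e1, Complex.Gamma_add_one _ hne, norm_mul,
      Real.mul_rpow (x := 3 * ex) (y := 1 + |τ|) (by positivity) (by positivity),
      ← mul_assoc (_ ^ (1 - (7/12:ℝ))), ← Real.rpow_add (by positivity)] at key
    norm_num at key
    have hn1 : 1 / 12 ≤ ‖(1 / 12 + (τ : ℂ) * Complex.I)‖ := by
      have := Complex.abs_re_le_norm (1 / 12 + (τ : ℂ) * Complex.I)
      norm_num at this ⊢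
      exact this
    have hn2 : |τ| ≤ ‖(1 / 12 + (τ : ℂ) * Complex.I)‖ := by
      have := Complex.abs_im_le_norm (1 / 12 + (τ : ℂ) * Complex.I)
      simpa using this
    have hn3 : 1 + |τ| ≤ 13 * ‖(1 / 12 + (τ : ℂ) * Complex.I)‖ := by linarith
    have hpos : 0 < 1 + |τ| := by positivity
    have hsplit : (1 + |τ|) ^ (7 / 12 : ℝ) = (1 + |τ|) * (1 + |τ|) ^ (-(5 / 12) : ℝ) := by
      nth_rewrite 2 [← Real.rpow_one (1 + |τ|)]
      rw [← Real.rpow_add hpos]; norm_num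
    rw [hsplit] at key
    have hee : ex * Real.exp (π / 2 * |τ|) = 1 := by
      rw [hex, ← Real.exp_add]; simp
    set N := ‖Complex.Gamma (1 / 12 + (τ : ℂ) * Complex.I)‖ with hN
    set P := (1 + |τ|) ^ (-(5 / 12) : ℝ)
    have hN0 : 0 ≤ N := by rw [hN]; positivity
    have h4 : (1 + |τ|) * N ≤ (1 + |τ|) * (39 * Real.exp 4 * ex * P) := by
      calc (1 + |τ|) * N ≤ (13 * ‖(1 / 12 : ℂ) + (τ : ℂ) * Complex.I‖) * N := by gcongr
        _ = 13 * (‖(1 / 12 : ℂ) + (τ : ℂ) * Complex.I‖ * N) := by ring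
        _ ≤ 13 * (Real.exp 4 * (3 * ex * ((1 + |τ|) * P))) := by gcongr
        _ = _ := by ring
    have h5 := le_of_mul_le_mul_left h4 hpos
    calc N * Real.exp (π / 2 * |τ|) ≤ (39 * Real.exp 4 * ex * P) * Real.exp (π / 2 * |τ|) := by
          gcongr
      _ = 39 * Real.exp 4 * P * (ex * Real.exp (π / 2 * |τ|)) := by ring
      _ = _ := by rw [hee, mul_one]
  · intro z hz0 hz1
    have : DifferentiableAt ℂ Complex.Gamma (z + 1 / 2) := by
      apply Complex.differentiableAt_Gamma
      intro m hm
      have h2 := congrArg Complex.re hm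
      norm_num at h2
      have hm' : (0:ℝ) ≤ m := Nat.cast_nonneg m
      linarith
    exact this.comp z (by fun_prop : DifferentiableAt ℂ (fun s : ℂ => s + 1 / 2) z)
  · intro z hz0 hz1
    have hre : (z + 1 / 2).re = z.re + 1 / 2 := by norm_num
    refine (norm_gamma_le _ (by rw [hre]; linarith)).trans ?_
    rw [hre]
    exact (Real.le_norm_self _).trans (hM _ ⟨by linarith, by linarith⟩)
  · intro v
    beta_reduce
    rw [add_comm]
    calc _ ≤ _ := norm_gamma_half v
      _ ≤ 3 * (ex * Real.exp (2 * |v - τ|)) := by gcongr; exact hexp v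
      _ ≤ 3 * (ex * Real.exp (3 * |v - τ|)) := by gcongr; norm_num
      _ = _ := by ring
  · intro v
    beta_reduce
    have hne : (1 / 2 + (v : ℂ) * Complex.I) ≠ 0 := by
      intro h
      have := congrArg Complex.re h
      norm_num at this
    rw [show 1 + (v : ℂ) * Complex.I + 1 / 2 = (1 / 2 + (v : ℂ) * Complex.I) + 1 by ring,
      Complex.Gamma_add_one _ hne, norm_mul]
    have hn : ‖(1 / 2 + (v : ℂ) * Complex.I)‖ ≤ 1 + |v| := by
      refine (norm_add_le _ _).trans ?_
      simp
      norm_num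
    calc _ ≤ (1 + |v|) * (3 * Real.exp (-(π / 2) * |v|)) := by
          gcongr; exact norm_gamma_half v
      _ ≤ ((1 + |τ|) * Real.exp |v - τ|) * (3 * (ex * Real.exp (2 * |v - τ|))) := by
          gcongr
          · exact one_add_abs_le v τ
          · exact hexp v
      _ = 3 * ex * (1 + |τ|) * (Real.exp |v - τ| * Real.exp (2 * |v - τ|)) := by ring
      _ = _ := by rw [← Real.exp_add]; ring_nf

lemma Q_norm (d : ℕ) (s : ℂ) : ‖Qfun d s‖ =
    ‖Complex.Gamma (((d : ℂ) - 1) / 2 + s)‖ /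
      ‖Complex.Gamma (((d : ℂ) - 1) / 2 + s + ((1 - 2 * s.re : ℝ) : ℂ))‖ := by
  rw [Qfun, norm_div]
  congr 1
  rw [← Complex.norm_conj, ← Complex.Gamma_conj]
  congr 2
  apply Complex.ext
  · simp [Complex.conj_ofNat]; ring
  · simp [Complex.conj_ofNat]

lemma z_re (d : ℕ) (s : ℂ) : (((d : ℂ) - 1) / 2 + s).re = ((d : ℝ) - 1) / 2 + s.re := by
  simp

lemma z_im (d : ℕ) (s : ℂ) : (((d : ℂ) - 1) / 2 + s).im = s.im := by
  simp

lemma Q_le (d : ℕ) (s : ℂ) (h0 : 0 < ((d : ℝ) - 1) / 2 + s.re) (h1 : s.re ≤ 1 / 2) :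
    ‖Qfun d s‖ ≤ Real.Gamma (((d : ℝ) - 1) / 2 + s.re) /
      Real.Gamma (((d : ℝ) - 1) / 2 + s.re + (1 - 2 * s.re)) := by
  rw [Q_norm]
  have h := gamma_ratio_le (((d : ℂ) - 1) / 2 + s) (by rwa [z_re]) (1 - 2 * s.re) (by linarith)
  rw [z_re] at h
  have hp : 0 < Real.Gamma (((d : ℝ) - 1) / 2 + s.re + (1 - 2 * s.re)) :=
    Real.Gamma_pos_of_pos (by linarith)
  have hne : 0 < ‖Complex.Gamma (((d : ℂ) - 1) / 2 + s + ((1 - 2 * s.re : ℝ) : ℂ))‖ := by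
    rw [norm_pos_iff]
    apply Complex.Gamma_ne_zero_of_re_pos
    rw [Complex.add_re, z_re, Complex.ofReal_re]
    linarith
  rw [div_le_div_iff₀ hne hp]
  exact h

lemma Q_decay (d : ℕ) (s : ℂ) (h0 : 0 < ((d : ℝ) - 1) / 2 + s.re) (h1 : s.re ≤ 0) :
    ‖Qfun d s‖ ≤ 1 / ‖((d : ℂ) - 1) / 2 + s‖ * (Real.Gamma (((d : ℝ) - 1) / 2 + s.re + 1) /
      Real.Gamma (((d : ℝ) - 1) / 2 + s.re + (1 - 2 * s.re))) := by
  rw [Q_norm]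
  have h := gamma_ratio_le (((d : ℂ) - 1) / 2 + s + 1)
    (by rw [Complex.add_re, z_re, Complex.one_re]; linarith) (- 2 * s.re) (by linarith)
  have hz : ((d : ℂ) - 1) / 2 + s ≠ 0 := by
    intro h
    have := congrArg Complex.re h
    rw [z_re, Complex.zero_re] at this
    linarith
  rw [Complex.add_re, z_re, Complex.Gamma_add_one _ hz, norm_mul, Complex.one_re] at h
  have hp : 0 < Real.Gamma (((d : ℝ) - 1) / 2 + s.re + (1 - 2 * s.re)) :=
    Real.Gamma_pos_of_pos (by linarith)
  have hne : 0 < ‖Complex.Gamma (((d : ℂ) - 1) / 2 + s + ((1 - 2 * s.re : ℝ) : ℂ))‖ := by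
    rw [norm_pos_iff]
    apply Complex.Gamma_ne_zero_of_re_pos
    rw [Complex.add_re, z_re, Complex.ofReal_re]
    linarith
  have hzp : 0 < ‖((d : ℂ) - 1) / 2 + s‖ := norm_pos_iff.mpr hz
  rw [div_mul_div_comm, one_mul, div_le_div_iff₀ hne (by positivity)]
  have e1 : ((d : ℝ) - 1) / 2 + s.re + 1 + -2 * s.re =
    ((d : ℝ) - 1) / 2 + s.re + (1 - 2 * s.re) := by ring
  have e2 : ((d : ℂ) - 1) / 2 + s + 1 + ((-2 * s.re : ℝ) : ℂ) =
    ((d : ℂ) - 1) / 2 + s + ((1 - 2 * s.re : ℝ) : ℂ) := by push_cast; ring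
  rw [e1, e2] at h
  linarith

lemma Q_bdd (d : ℕ) (a b : ℝ) (ha : 0 < ((d : ℝ) - 1) / 2 + a) (hb : b ≤ 1 / 2) :
    ∃ M : ℝ, ∀ s : ℂ, a ≤ s.re → s.re ≤ b → ‖Qfun d s‖ ≤ M := by
  obtain ⟨M, hM⟩ : ∃ M, ∀ x ∈ Set.Icc a b, ‖Real.Gamma (((d : ℝ) - 1) / 2 + x) /
      Real.Gamma (((d : ℝ) - 1) / 2 + x + (1 - 2 * x))‖ ≤ M := by
    apply isCompact_Icc.exists_bound_of_continuousOn
    intro x hx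
    have hx1 := hx.1
    have hx2 := hx.2
    have hG : ∀ w : ℝ, 0 < w → ContinuousAt Real.Gamma w := by
      intro w hw
      apply (Real.differentiableAt_Gamma _).continuousAt
      intro m
      have hm : (0:ℝ) ≤ m := Nat.cast_nonneg m
      linarith
    apply ContinuousAt.continuousWithinAt
    apply ContinuousAt.div
    · exact ContinuousAt.comp (f := fun x : ℝ => ((d : ℝ) - 1) / 2 + x)
        (hG _ (by linarith)) (by fun_prop)
    · exact ContinuousAt.comp (f := fun x : ℝ => ((d : ℝ) - 1) / 2 + x + (1 - 2 * x))
        (hG _ (by linarith)) (by fun_prop)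
    · exact (Real.Gamma_pos_of_pos (by linarith)).ne'
  refine ⟨M, fun s h1 h2 => ?_⟩
  exact (Q_le d s (by linarith) (by linarith)).trans
    ((Real.le_norm_self _).trans (hM _ ⟨h1, h2⟩))

lemma Q_diff (d : ℕ) (s : ℂ) (h0 : 0 < ((d : ℝ) - 1) / 2 + s.re) :
    DifferentiableAt ℂ (Qfun d) s := by
  have h1 : DifferentiableAt ℂ Complex.Gamma (((d : ℂ) - 1) / 2 + s) := by
    apply Complex.differentiableAt_Gamma
    intro m hm
    have h2 := congrArg Complex.re hm
    rw [z_re] at h2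
    simp at h2
    have hm' : (0:ℝ) ≤ m := Nat.cast_nonneg m
    linarith
  have h2 : DifferentiableAt ℂ (fun w : ℂ => (Complex.Gamma w)⁻¹) (((d : ℂ) + 1) / 2 - s) :=
    Complex.differentiable_one_div_Gamma _
  have h3 := h1.comp s (by fun_prop : DifferentiableAt ℂ (fun s : ℂ => ((d : ℂ) - 1) / 2 + s) s)
  have h4 := h2.comp s (by fun_prop : DifferentiableAt ℂ (fun s : ℂ => ((d : ℂ) + 1) / 2 - s) s)
  have h5 := h3.mul h4
  exact h5

lemma Q_line (d : ℕ) (hd : 2 ≤ d) (τ : ℝ) :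
    ‖Qfun d (1 / 12 + (τ : ℂ) * Complex.I)‖ ≤
      4 * Real.exp 4 * (1 + |τ|) ^ (-(5 / 6) : ℝ) := by
  have hd' : (2 : ℝ) ≤ d := by exact_mod_cast hd
  have hre : ∀ s : ℂ, (s / 2).re = s.re / 2 := by intro s; simp
  obtain ⟨M, hM⟩ := Q_bdd d 0 (1 / 2) (by linarith) le_rfl
  have key := three_lines_local (fun s => Qfun d (s / 2)) ?_ M ?_ (2 * τ) (4 / (1 + |2 * τ|))
    1 (1 / 6) (by positivity) (by positivity) (by norm_num) (by norm_num) ?_ ?_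
  · beta_reduce at key
    have e1 : (((1 / 6 : ℝ) : ℂ) + ((2 * τ : ℝ) : ℂ) * Complex.I) / 2 =
        (1 / 12 + (τ : ℂ) * Complex.I) := by push_cast; ring
    rw [e1] at key
    refine key.trans ?_
    rw [Real.one_rpow, mul_one]
    have h1 : (4 / (1 + |2 * τ|)) ^ (1 - 1 / 6 : ℝ) ≤ 4 * (1 + |τ|) ^ (-(5 / 6) : ℝ) := by
      have h2 : 4 / (1 + |2 * τ|) ≤ 4 * (1 + |τ|)⁻¹ := by
        rw [← div_eq_mul_inv]
        have h3 : |2 * τ| = 2 * |τ| := by rw [abs_mul, abs_two]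
        rw [h3]
        exact div_le_div_of_nonneg_left (by norm_num) (by positivity)
          (by linarith [abs_nonneg τ])
      calc (4 / (1 + |2 * τ|)) ^ (1 - 1 / 6 : ℝ) ≤ (4 * (1 + |τ|)⁻¹) ^ (1 - 1 / 6 : ℝ) :=
            Real.rpow_le_rpow (by positivity) h2 (by norm_num)
        _ = 4 ^ (1 - 1 / 6 : ℝ) * (1 + |τ|) ^ (-(5 / 6) : ℝ) := by
            rw [Real.mul_rpow (by norm_num) (by positivity), Real.inv_rpow (by positivity),
              ← Real.rpow_neg (by positivity)]
            norm_num
        _ ≤ 4 ^ (1 : ℝ) * (1 + |τ|) ^ (-(5 / 6) : ℝ) := by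
            gcongr <;> norm_num
        _ = _ := by rw [Real.rpow_one]
    calc _ ≤ Real.exp 4 * (4 * (1 + |τ|) ^ (-(5 / 6) : ℝ)) := by gcongr
      _ = _ := by ring
  · intro z hz0 hz1
    have := Q_diff d (z / 2) (by rw [hre]; linarith)
    exact this.comp z (by fun_prop : DifferentiableAt ℂ (fun s : ℂ => s / 2) z)
  · intro z hz0 hz1
    exact hM _ (by rw [hre]; linarith) (by rw [hre]; linarith)
  · intro v
    beta_reduce
    have hr : ((v : ℂ) * Complex.I / 2).re = 0 := by simp
    have hi : ((v : ℂ) * Complex.I / 2).im = v / 2 := by simp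
    have h := Q_decay d ((v : ℂ) * Complex.I / 2) (by rw [hr]; linarith) (by rw [hr])
    rw [hr] at h
    simp only [mul_zero, sub_zero, add_zero] at h
    rw [div_self (Real.Gamma_pos_of_pos (by linarith)).ne', mul_one] at h
    set z := ((d : ℂ) - 1) / 2 + (v : ℂ) * Complex.I / 2 with hz
    have h1 : 1 / 2 ≤ ‖z‖ := by
      have := (le_abs_self _).trans (Complex.abs_re_le_norm z)
      rw [hz, z_re, hr] at this
      linarith
    have h2 : |v| / 2 ≤ ‖z‖ := by
      have := Complex.abs_im_le_norm z
      rw [hz, z_im, hi, abs_div, abs_two] at this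
      exact this
    have h3 := one_add_abs_le (2 * τ) v
    rw [abs_sub_comm] at h3
    calc _ ≤ 1 / ‖z‖ := h
      _ ≤ 4 / (1 + |v|) := by
        rw [div_le_div_iff₀ (by linarith) (by positivity)]
        linarith
      _ ≤ 4 / (1 + |2 * τ|) * Real.exp |v - 2 * τ| := by
        rw [div_mul_eq_mul_div, div_le_div_iff₀ (by positivity) (by positivity)]
        linarith
      _ ≤ _ := by
        gcongr
        linarith [abs_nonneg (v - 2 * τ)]
  · intro v
    beta_reduce
    have hr : ((1 + (v : ℂ) * Complex.I) / 2).re = 1 / 2 := by simp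
    have h := Q_le d ((1 + (v : ℂ) * Complex.I) / 2) (by rw [hr]; linarith) (by rw [hr])
    rw [hr] at h
    norm_num at h
    rw [div_self (Real.Gamma_pos_of_pos (by linarith)).ne'] at h
    rw [one_mul]
    exact h.trans (Real.one_le_exp (by positivity))

/-- The `r`-dependent part of the integrand after the change of variables. -/
def Wk (T ε0 ρ : ℝ) (d : ℕ) (Y : ℝ) (r : ℂ) (τ : ℝ) : ℂ :=
  Ffun T ε0 ρ r * specd d r *
    ((Y : ℂ) ^ (1 + 2 * r - (1 / 12 + (τ : ℂ) * Complex.I)) *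
      Qfun d (1 / 12 + (τ : ℂ) * Complex.I - 3 * r))

/-- The part of the integrand depending only on `u = s + 3r`. -/
def gk (e : ℝ) (τ : ℝ) : ℂ :=
  Complex.Gamma (1 / 12 + (τ : ℂ) * Complex.I) *
    Complex.exp ((e : ℂ) * Complex.I * (Real.pi : ℂ) * (1 / 12 + (τ : ℂ) * Complex.I) / 2)

lemma gk_bound (e : ℝ) (he : |e| ≤ 1) (τ : ℝ) :
    ‖gk e τ‖ ≤ 39 * Real.exp 4 * (1 + |τ|) ^ (-(5 / 12) : ℝ) := by
  refine le_trans ?_ (gamma_decay τ)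
  rw [gk, norm_mul, Complex.norm_exp]
  gcongr
  have h1 : ((e : ℂ) * Complex.I * (Real.pi : ℂ) * (1 / 12 + (τ : ℂ) * Complex.I) / 2).re =
      -(π / 2) * (e * τ) := by
    rw [show ((e : ℂ) * Complex.I * (Real.pi : ℂ) * (1 / 12 + (τ : ℂ) * Complex.I) / 2) =
      ((e * π * (1 / 12) / 2 : ℝ) : ℂ) * Complex.I +
        ((e * π * τ / 2 : ℝ) : ℂ) * (Complex.I * Complex.I) by push_cast; ring, Complex.I_mul_I]
    simp
    ring
  rw [h1]
  have h2 : -(e * τ) ≤ |τ| := by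
    refine (neg_le_abs _).trans ?_
    rw [abs_mul]
    exact mul_le_of_le_one_left (abs_nonneg _) he
  nlinarith [Real.pi_pos]

lemma gk_cont (e : ℝ) : Continuous (gk e) := by
  rw [continuous_iff_continuousAt]
  intro τ
  have h : ContinuousAt Complex.Gamma (1 / 12 + (τ : ℂ) * Complex.I) := by
    apply (Complex.differentiableAt_Gamma _ _).continuousAt
    intro m hm
    have h2 := congrArg Complex.re hm
    norm_num at h2
    have hm' : (0:ℝ) ≤ m := Nat.cast_nonneg m
    linarith
  have h1 := ContinuousAt.comp (f := fun τ : ℝ => (1 / 12 + (τ : ℂ) * Complex.I)) h (by fun_prop)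
  exact h1.mul (by fun_prop)

lemma Ffun_norm (T ε0 ρ a t : ℝ) : ‖Ffun T ε0 ρ ((a : ℂ) + (t : ℂ) * Complex.I)‖ =
    Real.exp ((a ^ 2 - (t - ρ) ^ 2) / T ^ ε0) := by
  rw [Ffun, Complex.norm_exp, Complex.div_ofReal_re]
  congr 2
  simp [pow_two]

lemma Fspec_bound (c2 ε0 A : ℝ) (hA : 0 ≤ A) (hc2 : 0 < c2) (hε : 0 < ε0) :
    ∃ H0 : ℝ, 0 ≤ H0 ∧ ∀ T : ℝ, 1 < T → ∀ d : ℕ, 2 ≤ d → (d : ℝ) ≤ c2 * T →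
      ∀ ρ : ℝ, |ρ| ≤ c2 * T → ∀ a t : ℝ, 0 ≤ a → a ≤ A →
      ‖Ffun T ε0 ρ ((a : ℂ) + (t : ℂ) * Complex.I)‖ *
        ‖specd d ((a : ℂ) + (t : ℂ) * Complex.I)‖ * (1 + 3 * |t|) ≤
      (H0 * (T ^ 4 * (T ^ ε0) ^ 3)) * (1 + (t - ρ) ^ 2)⁻¹ := by
  refine ⟨720 * Real.exp (A ^ 2 + 1) * c2 * (c2 + A + 1) ^ 3, by positivity, ?_⟩
  intro T hT d hd hdT ρ hρ a t ha0 haA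
  have hd' : (2 : ℝ) ≤ d := by exact_mod_cast hd
  set S := T ^ ε0 with hS
  have hS1 : 1 ≤ S := Real.one_le_rpow hT.le hε.le
  set V := t - ρ with hV
  have hV0 := abs_nonneg V
  set m := (c2 + A + 1) * T * (1 + |V|) with hm
  have hT0 : 0 < T := by linarith
  have ht : |t| ≤ c2 * T + |V| := by
    have : |t| ≤ |ρ| + |V| := by
      have := abs_add_le ρ V
      simpa [hV] using this
    linarith
  have hTV : 0 ≤ T * |V| := by positivity
  have hTT : 0 ≤ (T - 1) * |V| := mul_nonneg (by linarith) hV0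
  have hAT : 0 ≤ (T - 1) * A := mul_nonneg (by linarith) hA
  have hcV : 0 ≤ c2 * T * |V| := by positivity
  have hATV : 0 ≤ A * T * |V| := by positivity
  have hm1 : d ≤ m := by rw [hm]; nlinarith
  have hm2 : A + |t| ≤ m := by rw [hm]; nlinarith
  have hm3 : 1 + |t| ≤ m := by rw [hm]; nlinarith
  have hm0 : 0 ≤ m := by positivity
  have hF : ‖Ffun T ε0 ρ ((a : ℂ) + (t : ℂ) * Complex.I)‖ ≤
      Real.exp (A ^ 2 + 1) * (6 * S ^ 3 / (1 + V ^ 2) ^ 3) := by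
    rw [Ffun_norm]
    have h1 : (a ^ 2 - V ^ 2) / S ≤ (A ^ 2 + 1) + (-((1 + V ^ 2) / S)) := by
      have : (a ^ 2 - V ^ 2) / S = (a ^ 2 + 1) / S - (1 + V ^ 2) / S := by ring
      rw [this]
      have h2 : (a ^ 2 + 1) / S ≤ a ^ 2 + 1 := div_le_self (by positivity) hS1
      nlinarith
    refine (Real.exp_le_exp.mpr h1).trans ?_
    rw [Real.exp_add]
    gcongr
    have h3 := Real.pow_div_factorial_le_exp ((1 + V ^ 2) / S) (by positivity) 3
    rw [Real.exp_neg, inv_le_comm₀ (Real.exp_pos _) (by positivity)]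
    refine le_trans (le_of_eq ?_) h3
    rw [show ((Nat.factorial 3 : ℕ) : ℝ) = 6 by norm_num [Nat.factorial]]
    field_simp
  have hspec : ‖specd d ((a : ℂ) + (t : ℂ) * Complex.I)‖ ≤ c2 * T * (10 * m ^ 2) := by
    rw [specd, norm_mul, norm_mul]
    have e1 : ‖(1 / (8 * (Real.pi : ℂ) ^ 3))‖ ≤ 1 := by
      rw [norm_div, norm_mul, norm_pow, Complex.norm_real, Real.norm_of_nonneg Real.pi_pos.le]
      norm_num
      have : 1 ≤ π ^ 3 := one_le_pow₀ (by linarith [Real.pi_gt_three])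
      have h8 : (π ^ 3)⁻¹ ≤ 1 := inv_le_one_of_one_le₀ this
      linarith
    have e2 : ‖(d : ℂ) - 1‖ ≤ d := by
      rw [show (d : ℂ) - 1 = ((d - 1 : ℝ) : ℂ) by push_cast; rfl, Complex.norm_real,
        Real.norm_of_nonneg (by linarith)]
      linarith
    have e3 : ‖(a : ℂ) + (t : ℂ) * Complex.I‖ ≤ A + |t| := by
      refine (norm_add_le _ _).trans ?_
      simp [abs_of_nonneg ha0]
      exact haA
    have e4 : ‖((d : ℂ) - 1) ^ 2 / 4 - 9 * ((a : ℂ) + (t : ℂ) * Complex.I) ^ 2‖ ≤ 10 * m ^ 2 := by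
      refine (norm_sub_le _ _).trans ?_
      rw [norm_div, norm_mul, norm_pow, norm_pow]
      have h4 : ‖(4 : ℂ)‖ = 4 := by simp
      have h9 : ‖(9 : ℂ)‖ = 9 := by simp
      rw [h4, h9]
      have g1 : ‖(d : ℂ) - 1‖ ^ 2 ≤ m ^ 2 := pow_le_pow_left₀ (norm_nonneg _) (e2.trans hm1) 2
      have g2 : ‖(a : ℂ) + (t : ℂ) * Complex.I‖ ^ 2 ≤ m ^ 2 :=
        pow_le_pow_left₀ (norm_nonneg _) (e3.trans hm2) 2
      have : 0 ≤ m ^ 2 := by positivity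
      linarith
    calc _ ≤ 1 * (c2 * T) * (10 * m ^ 2) := by
          gcongr
          exact e2.trans hdT
      _ = _ := by ring
  have ht3 : 1 + 3 * |t| ≤ 3 * m := by linarith [abs_nonneg t]
  have hsq : (1 + |V|) ^ 3 ≤ 4 * (1 + V ^ 2) ^ 2 := by
    have h1 : (1 + |V|) ^ 2 ≤ 2 * (1 + V ^ 2) := by
      nlinarith [sq_abs V, sq_nonneg (1 - |V|)]
    calc (1 + |V|) ^ 3 ≤ (1 + |V|) ^ 4 := pow_le_pow_right₀ (by linarith) (by norm_num)
      _ = ((1 + |V|) ^ 2) ^ 2 := by ring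
      _ ≤ (2 * (1 + V ^ 2)) ^ 2 := by gcongr
      _ = _ := by ring
  calc _ ≤ (Real.exp (A ^ 2 + 1) * (6 * S ^ 3 / (1 + V ^ 2) ^ 3)) *
        (c2 * T * (10 * m ^ 2)) * (3 * m) := by gcongr
    _ = 180 * Real.exp (A ^ 2 + 1) * c2 * (c2 + A + 1) ^ 3 * T ^ 4 * S ^ 3 *
        ((1 + |V|) ^ 3 / (1 + V ^ 2) ^ 3) := by rw [hm]; ring
    _ ≤ 180 * Real.exp (A ^ 2 + 1) * c2 * (c2 + A + 1) ^ 3 * T ^ 4 * S ^ 3 *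
        ((4 * (1 + V ^ 2) ^ 2) / (1 + V ^ 2) ^ 3) := by gcongr
    _ = _ := by
        field_simp
        ring

lemma cpow_norm (Y : ℝ) (hY : 0 < Y) (a t τ : ℝ) :
    ‖(Y : ℂ) ^ (1 + 2 * ((a : ℂ) + (t : ℂ) * Complex.I) - (1 / 12 + (τ : ℂ) * Complex.I))‖ =
      Y ^ (11 / 12 + 2 * a) := by
  rw [Complex.norm_cpow_eq_rpow_re_of_pos hY]
  congr 1
  simp
  norm_num
  ring

lemma arg_eq (a t τ : ℝ) :
    (1 / 12 + (τ : ℂ) * Complex.I - 3 * ((a : ℂ) + (t : ℂ) * Complex.I)) =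
      ((1 / 12 - 3 * a : ℝ) : ℂ) + ((τ - 3 * t : ℝ) : ℂ) * Complex.I := by
  push_cast
  ring

lemma peetre (t τ : ℝ) : 1 + |τ| ≤ (1 + 3 * |t|) * (1 + |τ - 3 * t|) := by
  have h1 : |τ| ≤ |τ - 3 * t| + 3 * |t| := by
    have := abs_add_le (τ - 3 * t) (3 * t)
    rw [abs_mul, abs_of_pos (by norm_num : (0:ℝ) < 3)] at this
    simpa using this
  nlinarith [abs_nonneg t, abs_nonneg (τ - 3 * t)]

lemma Wk_diff (T ε0 ρ : ℝ) (d : ℕ) (Y : ℝ) (hY : 0 < Y) (r : ℂ) (τ : ℝ)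
    (hr : 0 < ((d : ℝ) - 1) / 2 + 1 / 12 - 3 * r.re) :
    DifferentiableAt ℂ (fun r => Wk T ε0 ρ d Y r τ) r := by
  have hY' : (Y : ℂ) ≠ 0 := by exact_mod_cast hY.ne'
  unfold Wk
  have h1 : DifferentiableAt ℂ (fun r => Ffun T ε0 ρ r) r := by unfold Ffun; fun_prop
  have h2 : DifferentiableAt ℂ (fun r => specd d r) r := by unfold specd; fun_prop
  have h3 : DifferentiableAt ℂ
      (fun r : ℂ => (Y : ℂ) ^ (1 + 2 * r - (1 / 12 + (τ : ℂ) * Complex.I))) r := by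
    apply DifferentiableAt.const_cpow (by fun_prop) (Or.inl hY')
  have h4 : DifferentiableAt ℂ
      (fun r : ℂ => Qfun d (1 / 12 + (τ : ℂ) * Complex.I - 3 * r)) r := by
    have := Q_diff d (1 / 12 + (τ : ℂ) * Complex.I - 3 * r) (by
      simp
      norm_num at hr
      linarith)
    exact DifferentiableAt.comp (g := Qfun d)
      (f := fun r : ℂ => 1 / 12 + (τ : ℂ) * Complex.I - 3 * r) r this (by fun_prop)
  exact (h1.mul h2).mul (h3.mul h4)

lemma Wk_cont (T ε0 ρ : ℝ) (d : ℕ) (hd : 2 ≤ d) (Y : ℝ) (hY : 0 < Y) :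
    Continuous (fun p : ℝ × ℝ => Wk T ε0 ρ d Y ((p.1 : ℂ) * Complex.I) p.2) := by
  have hY' : (Y : ℂ) ≠ 0 := by exact_mod_cast hY.ne'
  have hd' : (2 : ℝ) ≤ d := by exact_mod_cast hd
  unfold Wk
  have h1 : Continuous (fun p : ℝ × ℝ => Ffun T ε0 ρ ((p.1 : ℂ) * Complex.I)) := by
    unfold Ffun; fun_prop
  have h2 : Continuous (fun p : ℝ × ℝ => specd d ((p.1 : ℂ) * Complex.I)) := by
    unfold specd; fun_prop
  have h3 : Continuous (fun p : ℝ × ℝ => (Y : ℂ) ^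
      (1 + 2 * ((p.1 : ℂ) * Complex.I) - (1 / 12 + (p.2 : ℂ) * Complex.I))) := by
    apply Continuous.const_cpow (by fun_prop) (Or.inl hY')
  have h4 : Continuous (fun p : ℝ × ℝ =>
      Qfun d (1 / 12 + (p.2 : ℂ) * Complex.I - 3 * ((p.1 : ℂ) * Complex.I))) := by
    rw [continuous_iff_continuousAt]
    intro p
    have := (Q_diff d (1 / 12 + (p.2 : ℂ) * Complex.I - 3 * ((p.1 : ℂ) * Complex.I)) (by
      simp
      linarith)).continuousAt
    exact ContinuousAt.comp (g := Qfun d)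
      (f := fun p : ℝ × ℝ => 1 / 12 + (p.2 : ℂ) * Complex.I - 3 * ((p.1 : ℂ) * Complex.I))
      this (by fun_prop)
  exact (h1.mul h2).mul (h3.mul h4)

lemma Kw4_eq (y : ℝ) (d : ℕ) (t : ℝ) : Kw4 y d ((t : ℂ) * Complex.I) =
    (((Real.sign y : ℂ) * Complex.I) ^ d / (4 * (Real.pi : ℂ) ^ 2)) *
    (1 / (2 * (Real.pi : ℂ))) *
    ∫ τ : ℝ, ((|8 * Real.pi ^ 3 * y| : ℝ) : ℂ) ^
        (1 + 2 * ((t : ℂ) * Complex.I) - (1 / 12 + (τ : ℂ) * Complex.I)) *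
      Qfun d (1 / 12 + (τ : ℂ) * Complex.I - 3 * ((t : ℂ) * Complex.I)) *
      gk (Real.sign y) τ := by
  rw [Kw4]
  congr 1
  rw [← integral_sub_right_eq_self _ (3 * t)]
  congr 1
  funext τ
  have e1 : (1 : ℂ) - (t : ℂ) * Complex.I - ((1 / 12 : ℂ) + ((τ - 3 * t : ℝ) : ℂ) * Complex.I) =
    1 + 2 * ((t : ℂ) * Complex.I) - (1 / 12 + (τ : ℂ) * Complex.I) := by push_cast; ring
  have e2 : (1 / 12 : ℂ) + ((τ - 3 * t : ℝ) : ℂ) * Complex.I =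
    1 / 12 + (τ : ℂ) * Complex.I - 3 * ((t : ℂ) * Complex.I) := by push_cast; ring
  rw [e1, e2, gk, sub_add_cancel]
  ring

lemma Phi_eq (T ε0 ρ : ℝ) (d : ℕ) (y : ℝ) : Phiw4 T ε0 ρ d y =
    (1 / ((|y| : ℝ) : ℂ)) * (1 / (2 * (Real.pi : ℂ))) *
    ((((Real.sign y : ℂ) * Complex.I) ^ d / (4 * (Real.pi : ℂ) ^ 2)) *
    (1 / (2 * (Real.pi : ℂ)))) * ∫ t : ℝ, ∫ τ : ℝ,
      Wk T ε0 ρ d |8 * Real.pi ^ 3 * y| ((t : ℂ) * Complex.I) τ * gk (Real.sign y) τ := by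
  rw [Phiw4, mul_assoc _ (_ * _) (integral _ _)]
  congr 1
  rw [← integral_const_mul]
  congr 1
  funext t
  rw [Kw4_eq]
  have : ∀ τ : ℝ, Wk T ε0 ρ d |8 * Real.pi ^ 3 * y| ((t : ℂ) * Complex.I) τ * gk (Real.sign y) τ =
      (Ffun T ε0 ρ ((t : ℂ) * Complex.I) * specd d ((t : ℂ) * Complex.I)) *
      (((|8 * Real.pi ^ 3 * y| : ℝ) : ℂ) ^
        (1 + 2 * ((t : ℂ) * Complex.I) - (1 / 12 + (τ : ℂ) * Complex.I)) *
      Qfun d (1 / 12 + (τ : ℂ) * Complex.I - 3 * ((t : ℂ) * Complex.I)) *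
      gk (Real.sign y) τ) := by
    intro τ
    rw [Wk]
    ring
  simp_rw [this]
  rw [integral_const_mul]
  ring

lemma lorentz_int (ρ : ℝ) : Integrable (fun t : ℝ => (1 + (t - ρ) ^ 2)⁻¹) :=
  integrable_inv_one_add_sq.comp_sub_right ρ

lemma lorentz_val (ρ : ℝ) : ∫ t : ℝ, (1 + (t - ρ) ^ 2)⁻¹ = π := by
  rw [integral_sub_right_eq_self (fun t : ℝ => (1 + t ^ 2)⁻¹) ρ]
  exact integral_univ_inv_one_add_sq

lemma lorentz_top (ρ : ℝ) :
    Filter.Tendsto (fun t : ℝ => (1 + (t - ρ) ^ 2)⁻¹) Filter.atTop (nhds 0) := by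
  apply Filter.Tendsto.inv_tendsto_atTop
  apply Filter.tendsto_atTop_add_const_left
  exact (Filter.tendsto_pow_atTop two_ne_zero).comp
    (Filter.tendsto_atTop_add_const_right _ (-ρ) Filter.tendsto_id)

lemma lorentz_bot (ρ : ℝ) :
    Filter.Tendsto (fun t : ℝ => (1 + (t - ρ) ^ 2)⁻¹) Filter.atBot (nhds 0) := by
  have h := (lorentz_top (-ρ)).comp Filter.tendsto_neg_atBot_atTop
  refine h.congr fun t => ?_
  simp only [Function.comp]
  congr 2
  ring

lemma japanese_int (p : ℝ) (hp : 1 < p) : Integrable (fun τ : ℝ => (1 + |τ|) ^ (-p)) := by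
  have := integrable_one_add_norm (E := ℝ) (μ := volume) (r := p) (by simpa using hp)
  simpa using this

/-- Absolute constant in the main bound. -/
def K0 : ℝ := 156 * Real.exp 4 * π * ∫ τ : ℝ, (1 + |τ|) ^ (-(17 / 12) : ℝ)

lemma double_int (T ε0 ρ : ℝ) (d : ℕ) (hd : 2 ≤ d) (Y : ℝ) (hY : 0 < Y) (e : ℝ) (he : |e| ≤ 1)
    (H : ℝ)
    (hH : ∀ t : ℝ, ‖Ffun T ε0 ρ ((t : ℂ) * Complex.I)‖ *
        ‖specd d ((t : ℂ) * Complex.I)‖ * (1 + 3 * |t|) ≤ H * (1 + (t - ρ) ^ 2)⁻¹) :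
    Integrable (fun p : ℝ × ℝ => Wk T ε0 ρ d Y ((p.1 : ℂ) * Complex.I) p.2 * gk e p.2)
      (volume.prod volume) := by
  have hdom := ((lorentz_int ρ).const_mul (H * Y ^ (11 / 12 : ℝ) * (4 * Real.exp 4) *
    (39 * Real.exp 4))).mul_prod (japanese_int (5 / 4) (by norm_num))
  refine hdom.mono' ((Wk_cont T ε0 ρ d hd Y hY).mul
    ((gk_cont e).comp continuous_snd)).aestronglyMeasurable ?_
  refine Filter.Eventually.of_forall fun p => ?_
  obtain ⟨t, τ⟩ := p
  simp only
  rw [norm_mul, Wk, norm_mul, norm_mul, norm_mul]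
  have hc := cpow_norm Y hY 0 t τ
  simp only [Complex.ofReal_zero, zero_add, mul_zero, add_zero] at hc
  rw [hc]
  have hg := gk_bound e he τ
  have ha := arg_eq 0 t τ
  simp only [Complex.ofReal_zero, zero_add, mul_zero, sub_zero] at ha
  rw [ha]
  have hq := Q_line d hd (τ - 3 * t)
  have e12 : ((1 / 12 : ℝ) : ℂ) = 1 / 12 := by push_cast; rfl
  rw [e12]
  have hp := peetre t τ
  have h0 : 0 < 1 + |τ| := by positivity
  have h1 : 0 < 1 + |τ - 3 * t| := by positivity
  have h2 : 1 ≤ 1 + 3 * |t| := by linarith [abs_nonneg t]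
  have hpe : (1 + |τ - 3 * t|) ^ (-(5 / 6) : ℝ) ≤ (1 + 3 * |t|) * (1 + |τ|) ^ (-(5 / 6) : ℝ) := by
    have h3 : (1 + |τ|) ^ (5 / 6 : ℝ) ≤ (1 + 3 * |t|) * (1 + |τ - 3 * t|) ^ (5 / 6 : ℝ) := by
      calc (1 + |τ|) ^ (5 / 6 : ℝ) ≤ ((1 + 3 * |t|) * (1 + |τ - 3 * t|)) ^ (5 / 6 : ℝ) :=
            Real.rpow_le_rpow h0.le hp (by norm_num)
        _ = (1 + 3 * |t|) ^ (5 / 6 : ℝ) * (1 + |τ - 3 * t|) ^ (5 / 6 : ℝ) :=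
            Real.mul_rpow (by linarith) h1.le
        _ ≤ _ := by
            gcongr
            exact Real.rpow_le_self_of_one_le h2 (by norm_num)
    rw [Real.rpow_neg h1.le, Real.rpow_neg h0.le, ← div_eq_mul_inv, ← one_div,
      div_le_div_iff₀ (by positivity) (by positivity)]
    linarith
  have hFs : ‖Ffun T ε0 ρ ((t : ℂ) * Complex.I)‖ * ‖specd d ((t : ℂ) * Complex.I)‖ *
      (1 + 3 * |t|) ≤ H * (1 + (t - ρ) ^ 2)⁻¹ := hH t
  calc _ ≤ ‖Ffun T ε0 ρ ((t : ℂ) * Complex.I)‖ * ‖specd d ((t : ℂ) * Complex.I)‖ *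
        (Y ^ (11 / 12 : ℝ) * (4 * Real.exp 4 * ((1 + 3 * |t|) * (1 + |τ|) ^ (-(5 / 6) : ℝ)))) *
        (39 * Real.exp 4 * (1 + |τ|) ^ (-(5 / 12) : ℝ)) := by
        gcongr
        refine hq.trans ?_
        gcongr
    _ = (‖Ffun T ε0 ρ ((t : ℂ) * Complex.I)‖ * ‖specd d ((t : ℂ) * Complex.I)‖ *
          (1 + 3 * |t|)) * (Y ^ (11 / 12 : ℝ) * (4 * Real.exp 4) * (39 * Real.exp 4) *
        ((1 + |τ|) ^ (-(5 / 6) : ℝ) * (1 + |τ|) ^ (-(5 / 12) : ℝ))) := by ring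
    _ ≤ (H * (1 + (t - ρ) ^ 2)⁻¹) * (Y ^ (11 / 12 : ℝ) * (4 * Real.exp 4) * (39 * Real.exp 4) *
        ((1 + |τ|) ^ (-(5 / 6) : ℝ) * (1 + |τ|) ^ (-(5 / 12) : ℝ))) := by gcongr
    _ = _ := by
        rw [← Real.rpow_add h0]
        norm_num
        ring

lemma shift_tau (T ε0 ρ : ℝ) (d : ℕ) (Y : ℝ) (hY : 0 < Y) (A : ℝ) (hA : 0 ≤ A)
    (hx : 0 < ((d : ℝ) - 1) / 2 + 1 / 12 - 3 * A) (H : ℝ)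
    (hH : ∀ a t : ℝ, 0 ≤ a → a ≤ A → ‖Ffun T ε0 ρ ((a : ℂ) + (t : ℂ) * Complex.I)‖ *
        ‖specd d ((a : ℂ) + (t : ℂ) * Complex.I)‖ * (1 + 3 * |t|) ≤ H * (1 + (t - ρ) ^ 2)⁻¹)
    (τ : ℝ) :
    ∫ t : ℝ, Wk T ε0 ρ d Y ((t : ℂ) * Complex.I) τ =
      ∫ t : ℝ, Wk T ε0 ρ d Y ((A : ℂ) + (t : ℂ) * Complex.I) τ := by
  obtain ⟨M, hM⟩ := Q_bdd d (1 / 12 - 3 * A) (1 / 12) (by linarith) (by norm_num)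
  set M' := max M 0
  set Z := (max Y 1) ^ (11 / 12 + 2 * A) with hZ
  have hlim : ∀ l : Filter ℝ, Filter.Tendsto (fun t : ℝ => (1 + (t - ρ) ^ 2)⁻¹) l (nhds 0) →
      Filter.Tendsto (fun t : ℝ => (H * Z * M') * (1 + (t - ρ) ^ 2)⁻¹) l (nhds 0) := by
    intro l hl
    simpa using hl.const_mul (H * Z * M')
  refine contour_shift (fun r => Wk T ε0 ρ d Y r τ) A hA ?_
    (fun t => (H * Z * M') * (1 + (t - ρ) ^ 2)⁻¹) ((lorentz_int ρ).const_mul _)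
    (hlim _ (lorentz_top ρ)) (hlim _ (lorentz_bot ρ)) ?_
  · intro z hz0 hz1
    exact Wk_diff T ε0 ρ d Y hY z τ (by linarith)
  · intro x t hx0 hx1
    rw [Wk, norm_mul, norm_mul, norm_mul, cpow_norm Y hY]
    have h1 : Y ^ (11 / 12 + 2 * x) ≤ Z := by
      calc Y ^ (11 / 12 + 2 * x) ≤ (max Y 1) ^ (11 / 12 + 2 * x) :=
            Real.rpow_le_rpow hY.le (le_max_left _ _) (by linarith)
        _ ≤ _ := Real.rpow_le_rpow_of_exponent_le (le_max_right _ _) (by linarith)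
    have h2 : ‖Qfun d (1 / 12 + (τ : ℂ) * Complex.I - 3 * ((x : ℂ) + (t : ℂ) * Complex.I))‖
        ≤ M' := by
      rw [arg_eq]
      refine (hM _ ?_ ?_).trans (le_max_left _ _)
      · simp only [Complex.add_re, Complex.ofReal_re, Complex.mul_re, Complex.I_re, mul_zero,
          Complex.ofReal_im, Complex.I_im, mul_one, sub_self, add_zero]
        linarith
      · simp only [Complex.add_re, Complex.ofReal_re, Complex.mul_re, Complex.I_re, mul_zero,
          Complex.ofReal_im, Complex.I_im, mul_one, sub_self, add_zero]
        linarith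
    have h3 : ‖Ffun T ε0 ρ ((x : ℂ) + (t : ℂ) * Complex.I)‖ *
        ‖specd d ((x : ℂ) + (t : ℂ) * Complex.I)‖ ≤ H * (1 + (t - ρ) ^ 2)⁻¹ :=
      (le_mul_of_one_le_right (by positivity) (by linarith [abs_nonneg t])).trans
        (hH x t hx0 hx1)
    have hZ0 : 0 ≤ Z := by positivity
    have hM0 : 0 ≤ M' := le_max_right _ _
    calc _ ≤ (H * (1 + (t - ρ) ^ 2)⁻¹) * (Z * M') := by
          gcongr
          exact le_trans (by positivity) h3
      _ = _ := by ring

lemma main_bound (T ε0 ρ : ℝ) (d : ℕ) (hd : 2 ≤ d) (y : ℝ) (hy : y ≠ 0) (A : ℝ)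
    (hA : 1 / 36 ≤ A) (hx : 1 / 3 ≤ ((d : ℝ) - 1) / 2 + 1 / 12 - 3 * A) (H : ℝ)
    (hH : ∀ a t : ℝ, 0 ≤ a → a ≤ A → ‖Ffun T ε0 ρ ((a : ℂ) + (t : ℂ) * Complex.I)‖ *
        ‖specd d ((a : ℂ) + (t : ℂ) * Complex.I)‖ * (1 + 3 * |t|) ≤ H * (1 + (t - ρ) ^ 2)⁻¹) :
    ‖Phiw4 T ε0 ρ d y‖ ≤ K0 * (|y|⁻¹ * (8 * π ^ 3 * |y|) ^ (11 / 12 + 2 * A)) *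
      (Real.Gamma (((d : ℝ) - 1) / 2 + 1 / 12 - 3 * A + 1) /
        Real.Gamma (((d : ℝ) - 1) / 2 + 1 / 12 - 3 * A + (5 / 6 + 6 * A))) * H := by
  set Y := |8 * π ^ 3 * y| with hYdef
  have hYeq : 8 * π ^ 3 * |y| = Y := by
    rw [hYdef, abs_mul, abs_of_pos (by positivity : 0 < 8 * π ^ 3)]
  have hY : 0 < Y := by rw [hYdef]; positivity
  have hsgn : |Real.sign y| = 1 := by
    rcases lt_or_gt_of_ne hy with h | h
    · rw [Real.sign_of_neg h]; norm_num
    · rw [Real.sign_of_pos h]; norm_num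
  set e := Real.sign y with he
  set R := Real.Gamma (((d : ℝ) - 1) / 2 + 1 / 12 - 3 * A + 1) /
        Real.Gamma (((d : ℝ) - 1) / 2 + 1 / 12 - 3 * A + (5 / 6 + 6 * A)) with hR
  have hR0 : 0 ≤ R := div_nonneg (Real.Gamma_pos_of_pos (by linarith)).le
    (Real.Gamma_pos_of_pos (by linarith)).le
  rw [hYeq, Phi_eq, ← hYdef]
  have hH0 : ∀ t : ℝ, ‖Ffun T ε0 ρ ((t : ℂ) * Complex.I)‖ *
        ‖specd d ((t : ℂ) * Complex.I)‖ * (1 + 3 * |t|) ≤ H * (1 + (t - ρ) ^ 2)⁻¹ := by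
    intro t
    simpa using hH 0 t le_rfl (by linarith)
  have hswap := integral_integral_swap
    (f := fun t τ : ℝ => Wk T ε0 ρ d Y ((t : ℂ) * Complex.I) τ * gk e τ)
    (double_int T ε0 ρ d hd Y hY e hsgn.le H hH0)
  rw [hswap]
  simp_rw [integral_mul_const]
  simp_rw [shift_tau T ε0 ρ d Y hY A (by linarith) (by linarith) H hH]
  have hpt : ∀ t τ : ℝ, ‖Wk T ε0 ρ d Y ((A : ℂ) + (t : ℂ) * Complex.I) τ‖ ≤
      (4 * Y ^ (11 / 12 + 2 * A) * R * H * (1 + |τ|)⁻¹) * (1 + (t - ρ) ^ 2)⁻¹ := by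
    intro t τ
    rw [Wk, norm_mul, norm_mul, norm_mul, cpow_norm Y hY, arg_eq]
    set s : ℂ := ((1 / 12 - 3 * A : ℝ) : ℂ) + ((τ - 3 * t : ℝ) : ℂ) * Complex.I with hs
    have hsre : s.re = 1 / 12 - 3 * A := by
      simp only [hs, Complex.add_re, Complex.ofReal_re, Complex.mul_re, Complex.I_re, mul_zero,
          Complex.ofReal_im, Complex.I_im, mul_one, sub_self, add_zero]
    have hsim : s.im = τ - 3 * t := by
      simp only [hs, Complex.add_im, Complex.ofReal_re, Complex.mul_im, Complex.I_re, mul_zero,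
          Complex.ofReal_im, Complex.I_im, mul_one, add_zero, zero_add]
    have hq := Q_decay d s (by rw [hsre]; linarith) (by rw [hsre]; linarith)
    rw [hsre, show ((d : ℝ) - 1) / 2 + (1 / 12 - 3 * A) + 1 =
      ((d : ℝ) - 1) / 2 + 1 / 12 - 3 * A + 1 by ring,
      show ((d : ℝ) - 1) / 2 + (1 / 12 - 3 * A) + (1 - 2 * (1 / 12 - 3 * A)) =
      ((d : ℝ) - 1) / 2 + 1 / 12 - 3 * A + (5 / 6 + 6 * A) by ring, ← hR] at hq
    set z := ((d : ℂ) - 1) / 2 + s with hz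
    have h1 : 1 / 3 ≤ ‖z‖ := by
      have := (le_abs_self _).trans (Complex.abs_re_le_norm z)
      rw [hz, z_re, hsre] at this
      linarith
    have h2 : |τ - 3 * t| ≤ ‖z‖ := by
      have := Complex.abs_im_le_norm z
      rwa [hz, z_im, hsim] at this
    have hp := peetre t τ
    have ht0 := abs_nonneg t
    have h3 : 1 / ‖z‖ ≤ 4 * (1 + 3 * |t|) * (1 + |τ|)⁻¹ := by
      rw [← div_eq_mul_inv, div_le_div_iff₀ (by linarith) (by positivity)]
      nlinarith
    calc _ ≤ ‖Ffun T ε0 ρ ((A : ℂ) + (t : ℂ) * Complex.I)‖ *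
          ‖specd d ((A : ℂ) + (t : ℂ) * Complex.I)‖ *
          (Y ^ (11 / 12 + 2 * A) * ((4 * (1 + 3 * |t|) * (1 + |τ|)⁻¹) * R)) := by
          gcongr
          refine hq.trans ?_
          gcongr
      _ = (‖Ffun T ε0 ρ ((A : ℂ) + (t : ℂ) * Complex.I)‖ *
          ‖specd d ((A : ℂ) + (t : ℂ) * Complex.I)‖ * (1 + 3 * |t|)) *
          (4 * Y ^ (11 / 12 + 2 * A) * (1 + |τ|)⁻¹ * R) := by ring
      _ ≤ (H * (1 + (t - ρ) ^ 2)⁻¹) * (4 * Y ^ (11 / 12 + 2 * A) * (1 + |τ|)⁻¹ * R) :=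
          mul_le_mul_of_nonneg_right (hH A t (by linarith) le_rfl) (by positivity)
      _ = _ := by ring
  have hinner : ∀ τ : ℝ, ‖∫ t : ℝ, Wk T ε0 ρ d Y ((A : ℂ) + (t : ℂ) * Complex.I) τ‖ ≤
      (4 * Y ^ (11 / 12 + 2 * A) * R * H * (1 + |τ|)⁻¹) * π := by
    intro τ
    have := norm_integral_le_of_norm_le ((lorentz_int ρ).const_mul
      (4 * Y ^ (11 / 12 + 2 * A) * R * H * (1 + |τ|)⁻¹))
      (Filter.Eventually.of_forall fun t => hpt t τ)
    rwa [integral_const_mul, lorentz_val] at this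
  have houter : ‖∫ τ : ℝ, (∫ t : ℝ, Wk T ε0 ρ d Y ((A : ℂ) + (t : ℂ) * Complex.I) τ) * gk e τ‖ ≤
      (156 * Real.exp 4 * π * (Y ^ (11 / 12 + 2 * A) * R * H)) *
        ∫ τ : ℝ, (1 + |τ|) ^ (-(17 / 12) : ℝ) := by
    rw [← integral_const_mul]
    refine norm_integral_le_of_norm_le ((japanese_int (17 / 12) (by norm_num)).const_mul _)
      (Filter.Eventually.of_forall fun τ => ?_)
    rw [norm_mul]
    have h0 : 0 < 1 + |τ| := by positivity
    calc _ ≤ ((4 * Y ^ (11 / 12 + 2 * A) * R * H * (1 + |τ|)⁻¹) * π) *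
          (39 * Real.exp 4 * (1 + |τ|) ^ (-(5 / 12) : ℝ)) := by
          refine mul_le_mul (hinner τ) (gk_bound e hsgn.le τ) (norm_nonneg _)
            ((norm_nonneg _).trans (hinner τ))
      _ = (156 * Real.exp 4 * π * (Y ^ (11 / 12 + 2 * A) * R * H)) *
          ((1 + |τ|) ^ (-1 : ℝ) * (1 + |τ|) ^ (-(5 / 12) : ℝ)) := by
          rw [Real.rpow_neg_one]; ring
      _ = _ := by
          rw [← Real.rpow_add h0]; norm_num
  have hpi := Real.pi_gt_three
  have hpre : ‖(1 / ((|y| : ℝ) : ℂ)) * (1 / (2 * (Real.pi : ℂ))) *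
    ((((e : ℝ) : ℂ) * Complex.I) ^ d / (4 * (Real.pi : ℂ) ^ 2) *
    (1 / (2 * (Real.pi : ℂ))))‖ ≤ |y|⁻¹ := by
    have h2 : ‖(1 / (2 * (Real.pi : ℂ)))‖ ≤ 1 := by
      rw [norm_div, norm_mul, Complex.norm_real, Real.norm_of_nonneg Real.pi_pos.le, norm_one,
        Complex.norm_two, div_le_one (by positivity)]
      linarith
    have h4 : ‖(((e : ℝ) : ℂ) * Complex.I) ^ d / (4 * (Real.pi : ℂ) ^ 2)‖ ≤ 1 := by
      have h4' : ‖(4 : ℂ)‖ = 4 := by simp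
      rw [norm_div, norm_mul, norm_pow, norm_pow, norm_mul, Complex.norm_I, Complex.norm_real,
        Complex.norm_real, Real.norm_eq_abs, hsgn, Real.norm_of_nonneg Real.pi_pos.le,
        div_le_one (by positivity), h4', mul_one, one_pow]
      nlinarith
    have h1 : ‖(1 / ((|y| : ℝ) : ℂ))‖ = |y|⁻¹ := by
      rw [norm_div, norm_one, Complex.norm_real, norm_abs_eq_norm, Real.norm_eq_abs, one_div]
    rw [norm_mul, norm_mul, norm_mul, h1]
    have hy0 : 0 ≤ |y|⁻¹ := by positivity
    calc _ ≤ |y|⁻¹ * 1 * (1 * 1) := by gcongr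
      _ = _ := by ring
  rw [norm_mul]
  calc _ ≤ |y|⁻¹ * ((156 * Real.exp 4 * π * (Y ^ (11 / 12 + 2 * A) * R * H)) *
        ∫ τ : ℝ, (1 + |τ|) ^ (-(17 / 12) : ℝ)) :=
        mul_le_mul hpre houter (norm_nonneg _) (by positivity)
    _ = _ := by rw [K0]; ring


lemma K0_nonneg : 0 ≤ K0 := by
  have h : 0 ≤ ∫ τ : ℝ, (1 + |τ|) ^ (-(17 / 12) : ℝ) :=
    integral_nonneg fun τ => by positivity
  rw [K0]
  positivity

lemma Gamma_ratio (x : ℝ) (hx : 0 < x) (M : ℕ) :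
    Real.Gamma (x + 1) / Real.Gamma (x + (M + 1)) ≤ (x ^ M)⁻¹ := by
  have key : x ^ M * Real.Gamma (x + 1) ≤ Real.Gamma (x + (M + 1)) := by
    induction M with
    | zero => simp
    | succ k ih =>
      have h : x + (((k + 1 : ℕ) : ℝ) + 1) = (x + ((k : ℝ) + 1)) + 1 := by push_cast; ring
      have hpos : 0 < x + ((k : ℝ) + 1) := by positivity
      rw [h, Real.Gamma_add_one hpos.ne', pow_succ]
      have hk : (0 : ℝ) ≤ k := Nat.cast_nonneg k
      have hg := (Real.Gamma_pos_of_pos hpos).le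
      calc x ^ k * x * Real.Gamma (x + 1) = x * (x ^ k * Real.Gamma (x + 1)) := by ring
        _ ≤ x * Real.Gamma (x + ((k : ℝ) + 1)) := by gcongr
        _ ≤ _ := mul_le_mul_of_nonneg_right (by linarith) hg
  have hG : 0 < Real.Gamma (x + (M + 1)) := Real.Gamma_pos_of_pos (by positivity)
  rw [div_le_iff₀ hG, inv_mul_eq_div, le_div_iff₀ (by positivity), mul_comm]
  exact key

lemma large_d (c1 c2 ε0 B : ℝ) (hc1 : 0 < c1) (hc2 : 0 < c2) (M : ℕ) (hM1 : 1 ≤ M)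
    (hM : B + 4 + 3 * ε0 ≤ 2 * (M : ℝ) / 3) (H0 : ℝ) (hH0 : 0 ≤ H0) (T : ℝ) (hT : 1 < T)
    (d : ℕ) (hd : 2 ≤ d) (hdM : 2 * M + 2 ≤ d) (hd1 : c1 * T ≤ d) (hd2 : (d : ℝ) ≤ c2 * T)
    (y : ℝ) (hy : y ≠ 0) (hyd : |y| ≤ (d : ℝ) / 30) (A : ℝ) (hA : A = ((M : ℝ) + 1 / 6) / 6) :
    K0 * (|y|⁻¹ * (8 * π ^ 3 * |y|) ^ (11 / 12 + 2 * A)) *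
      (Real.Gamma (((d : ℝ) - 1) / 2 + 1 / 12 - 3 * A + 1) /
        Real.Gamma (((d : ℝ) - 1) / 2 + 1 / 12 - 3 * A + (5 / 6 + 6 * A))) *
        (H0 * (T ^ 4 * (T ^ ε0) ^ 3)) ≤
    (K0 * ((8 * π ^ 3) ^ (11 / 12 + 2 * A) * c2 ^ (2 * A - 1 / 12)) * ((c1 / 4) ^ M)⁻¹ * H0) *
      T ^ (-B) := by
  have hT0 : 0 < T := by linarith
  have hM1' : (1 : ℝ) ≤ M := by exact_mod_cast hM1
  have hdM' : 2 * (M : ℝ) + 2 ≤ d := by exact_mod_cast hdM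
  have hy0 : 0 < |y| := abs_pos.mpr hy
  have hp : 0 ≤ 2 * A - 1 / 12 := by rw [hA]; linarith
  have e1 : ((d : ℝ) - 1) / 2 + 1 / 12 - 3 * A = ((d : ℝ) - 1 - M) / 2 := by rw [hA]; ring
  have e2 : 5 / 6 + 6 * A = (M : ℝ) + 1 := by rw [hA]; ring
  have hx : c1 / 4 * T ≤ ((d : ℝ) - 1 - M) / 2 := by linarith
  have hx0 : 0 < c1 / 4 * T := by positivity
  have hxp : 0 < ((d : ℝ) - 1 - M) / 2 := by linarith
  rw [e1, e2]
  have hG : Real.Gamma (((d : ℝ) - 1 - M) / 2 + 1) /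
      Real.Gamma (((d : ℝ) - 1 - M) / 2 + ((M : ℝ) + 1)) ≤ ((c1 / 4 * T) ^ M)⁻¹ := by
    refine (Gamma_ratio _ hxp M).trans ?_
    gcongr
  have hY : |y|⁻¹ * (8 * π ^ 3 * |y|) ^ (11 / 12 + 2 * A) ≤
      (8 * π ^ 3) ^ (11 / 12 + 2 * A) * (c2 * T) ^ (2 * A - 1 / 12) := by
    have : |y|⁻¹ * (8 * π ^ 3 * |y|) ^ (11 / 12 + 2 * A) =
        (8 * π ^ 3) ^ (11 / 12 + 2 * A) * |y| ^ (2 * A - 1 / 12) := by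
      rw [Real.mul_rpow (by positivity) hy0.le,
        show 2 * A - 1 / 12 = (-1) + (11 / 12 + 2 * A) by ring, Real.rpow_add hy0 (-1),
        Real.rpow_neg_one]
      ring
    rw [this]
    have hle : |y| ≤ c2 * T := by
      have : (0 : ℝ) ≤ d := Nat.cast_nonneg d
      linarith
    gcongr
  have hK := K0_nonneg
  have hTT : T ^ (2 * A - 1 / 12) * (T ^ M)⁻¹ * (T ^ 4 * (T ^ ε0) ^ 3) ≤ T ^ (-B) := by
    rw [← Real.rpow_natCast T M, ← Real.rpow_neg hT0.le, ← Real.rpow_natCast T 4,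
      ← Real.rpow_natCast (T ^ ε0) 3, ← Real.rpow_mul hT0.le, ← Real.rpow_add hT0,
      ← Real.rpow_add hT0, ← Real.rpow_add hT0]
    apply Real.rpow_le_rpow_of_exponent_le hT.le
    rw [hA]
    push_cast
    linarith
  have hG0 : 0 ≤ Real.Gamma (((d : ℝ) - 1 - M) / 2 + 1) /
      Real.Gamma (((d : ℝ) - 1 - M) / 2 + ((M : ℝ) + 1)) :=
    div_nonneg (Real.Gamma_pos_of_pos (by positivity)).le
      (Real.Gamma_pos_of_pos (by positivity)).le
  calc _ ≤ K0 * ((8 * π ^ 3) ^ (11 / 12 + 2 * A) * (c2 * T) ^ (2 * A - 1 / 12)) *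
        ((c1 / 4 * T) ^ M)⁻¹ * (H0 * (T ^ 4 * (T ^ ε0) ^ 3)) := by gcongr
    _ = (K0 * ((8 * π ^ 3) ^ (11 / 12 + 2 * A) * c2 ^ (2 * A - 1 / 12)) * ((c1 / 4) ^ M)⁻¹ * H0) *
        (T ^ (2 * A - 1 / 12) * (T ^ M)⁻¹ * (T ^ 4 * (T ^ ε0) ^ 3)) := by
        rw [Real.mul_rpow hc2.le hT0.le, mul_pow, mul_inv]; ring
    _ ≤ _ := by gcongr

/-- The Gamma ratio for the choice `A = 1/24`. -/
def Rsmall (d : ℕ) : ℝ := Real.Gamma (((d : ℝ) - 1) / 2 + 1 / 12 - 3 * (1 / 24) + 1) /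
        Real.Gamma (((d : ℝ) - 1) / 2 + 1 / 12 - 3 * (1 / 24) + (5 / 6 + 6 * (1 / 24)))


/-- Lemma 3, rapid decay of `Φ_{w₄}`: fix `0 < c₁ ≤ c₂` and `ε > 0`.
For every `B ≥ 0` there is `C` such that for all `T > 1`, `d ≍ T`, `|ρ_f| ≍ T` and
`0 < |y| ≤ d/30`, one has `|Φ_{w₄}(y; d)| ≤ C T^{−B}`. -/
theorem statement14 (c1 c2 ε0 : ℝ) (hc1 : 0 < c1) (hc12 : c1 ≤ c2) (hε : 0 < ε0) :
    ∀ B : ℝ, 0 ≤ B → ∃ C : ℝ,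
      ∀ T : ℝ, 1 < T →
        ∀ d : ℕ, 2 ≤ d → c1 * T ≤ (d : ℝ) → (d : ℝ) ≤ c2 * T →
          ∀ ρf : ℝ, c1 * T ≤ |ρf| → |ρf| ≤ c2 * T →
            ∀ y : ℝ, y ≠ 0 → |y| ≤ (d : ℝ) / 30 →
              ‖Phiw4 T ε0 ρf d y‖ ≤ C * T ^ (-B) := by
  intro B hB
  have hc2 : 0 < c2 := lt_of_lt_of_le hc1 hc12
  obtain ⟨M, hM⟩ := exists_nat_ge (3 * (B + 4 + 3 * ε0) / 2)
  have hM1' : (1 : ℝ) ≤ M := by linarith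
  have hM1 : 1 ≤ M := by exact_mod_cast hM1'
  set A : ℝ := ((M : ℝ) + 1 / 6) / 6 with hA
  have hA0 : 1 / 24 ≤ A := by rw [hA]; linarith
  obtain ⟨H0, hH0, hF⟩ := Fspec_bound c2 ε0 A (by linarith) hc2 hε
  have hK := K0_nonneg
  set T1 : ℝ := (2 * (M : ℝ) + 2) / c1 with hT1
  have hT1p : 0 < T1 := by positivity
  set S : ℝ := ∑ d ∈ Finset.range (2 * M + 2), |Rsmall d| with hS
  have hS0 : 0 ≤ S := Finset.sum_nonneg fun _ _ => abs_nonneg _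
  set C1 : ℝ := K0 * (8 * π ^ 3) * S * (H0 * (T1 ^ 4 * (T1 ^ ε0) ^ 3)) * T1 ^ B with hC1
  set C2 : ℝ := K0 * ((8 * π ^ 3) ^ (11 / 12 + 2 * A) * c2 ^ (2 * A - 1 / 12)) *
    ((c1 / 4) ^ M)⁻¹ * H0 with hC2
  have hC1p : 0 ≤ C1 := by positivity
  have hC2p : 0 ≤ C2 := by positivity
  refine ⟨C1 + C2, fun T hT d hd hd1 hd2 ρf _ hρ y hy hyd => ?_⟩
  have hT0 : 0 < T := by linarith
  have hd' : (2 : ℝ) ≤ d := by exact_mod_cast hd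
  have hTB : 0 ≤ T ^ (-B) := by positivity
  have hH := hF T hT d hd hd2 ρf hρ
  rcases lt_or_ge d (2 * M + 2) with hlt | hge
  · have hb := main_bound T ε0 ρf d hd y hy (1 / 24) (by norm_num) (by linarith)
      (H0 * (T ^ 4 * (T ^ ε0) ^ 3)) (fun a t h0 h1 => hH a t h0 (h1.trans hA0))
    have hlt' : (d : ℝ) ≤ 2 * (M : ℝ) + 2 := by exact_mod_cast hlt.le
    have hTT1 : T ≤ T1 := by
      rw [hT1, le_div_iff₀ hc1]; linarith
    have hR : Rsmall d ≤ S := (le_abs_self _).trans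
      (Finset.single_le_sum (f := fun d => |Rsmall d|) (fun _ _ => abs_nonneg _)
        (Finset.mem_range.mpr hlt))
    have hyy : |y|⁻¹ * (8 * π ^ 3 * |y|) ^ (11 / 12 + 2 * (1 / 24) : ℝ) = 8 * π ^ 3 := by
      rw [show (11 / 12 + 2 * (1 / 24) : ℝ) = 1 by norm_num, Real.rpow_one]
      have := abs_pos.mpr hy
      field_simp
    rw [hyy] at hb
    change _ ≤ K0 * (8 * π ^ 3) * Rsmall d * (H0 * (T ^ 4 * (T ^ ε0) ^ 3)) at hb
    have hone : 1 ≤ T1 ^ B * T ^ (-B) := by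
      rw [Real.rpow_neg hT0.le, ← div_eq_mul_inv, one_le_div (by positivity)]
      gcongr
    calc _ ≤ _ := hb
      _ ≤ K0 * (8 * π ^ 3) * S * (H0 * (T1 ^ 4 * (T1 ^ ε0) ^ 3)) * 1 := by
        rw [mul_one]; gcongr
      _ ≤ K0 * (8 * π ^ 3) * S * (H0 * (T1 ^ 4 * (T1 ^ ε0) ^ 3)) * (T1 ^ B * T ^ (-B)) := by
        gcongr
      _ = C1 * T ^ (-B) := by rw [hC1]; ring
      _ ≤ _ := by gcongr; linarith
  · have hge' : 2 * (M : ℝ) + 2 ≤ d := by exact_mod_cast hge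
    have hb := main_bound T ε0 ρf d hd y hy A (by linarith) (by rw [hA]; linarith)
      (H0 * (T ^ 4 * (T ^ ε0) ^ 3)) hH
    refine hb.trans ((large_d c1 c2 ε0 B hc1 hc2 M hM1 (by linarith) H0 hH0 T hT d hd hge hd1 hd2
      y hy hyd A hA).trans ?_)
    gcongr
    linarith
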